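/- Let (S_L, S_R) be a partizan subtraction game with |S_L| ≥ 2 whose outcome is L for every heap size n > p. Let x₁ < x₂ be two elements of S_L and let d be an integer with d > p + max(S_R ∪ {x₂ − x₁}). Then the game (S_L, S_R ∪ {d}) is also eventually L: its outcome is L for every n > (d + x₂)·⌈(d + x₂)/(x₂ − x₁)⌉. -/

import Mathlib

mutual
def LeftFirstWins (SL SR : Finset ℕ) : ℕ → Prop
  | n => ∃ s ∈ SL, ∃ (_ : 0 < s) (_ : s ≤ n), ¬ RightFirstWins SL SR (n - s)
  termination_by n => n
  decreasing_by omega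
def RightFirstWins (SL SR : Finset ℕ) : ℕ → Prop
  | n => ∃ s ∈ SR, ∃ (_ : 0 < s) (_ : s ≤ n), ¬ LeftFirstWins SL SR (n - s)
  termination_by n => n
  decreasing_by omega
end

inductive Outcome | P | L | R | N
deriving DecidableEq

open Classical in
noncomputable def outcome (SL SR : Finset ℕ) (n : ℕ) : Outcome :=
  if LeftFirstWins SL SR n then
    if RightFirstWins SL SR n then .N else .L
  else
    if RightFirstWins SL SR n then .R else .P

theorem leftFirstWins_iff {SL SR : Finset ℕ} (h : ∀ s ∈ SL, 0 < s) (n : ℕ) :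
    LeftFirstWins SL SR n ↔ ∃ s ∈ SL, s ≤ n ∧ ¬ RightFirstWins SL SR (n - s) := by
  rw [LeftFirstWins]
  constructor
  · rintro ⟨s, hs, -, hn, hw⟩
    exact ⟨s, hs, hn, hw⟩
  · rintro ⟨s, hs, hn, hw⟩
    exact ⟨s, hs, h s hs, hn, hw⟩

theorem rightFirstWins_iff {SL SR : Finset ℕ} (h : ∀ s ∈ SR, 0 < s) (n : ℕ) :
    RightFirstWins SL SR n ↔ ∃ s ∈ SR, s ≤ n ∧ ¬ LeftFirstWins SL SR (n - s) := by
  rw [RightFirstWins]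
  constructor
  · rintro ⟨s, hs, -, hn, hw⟩
    exact ⟨s, hs, hn, hw⟩
  · rintro ⟨s, hs, hn, hw⟩
    exact ⟨s, hs, h s hs, hn, hw⟩

theorem outcome_eq_L_iff (SL SR : Finset ℕ) (n : ℕ) :
    outcome SL SR n = .L ↔ LeftFirstWins SL SR n ∧ ¬ RightFirstWins SL SR n := by
  unfold outcome
  split_ifs <;> simp_all

/-- On heaps smaller than `d`, the extra move `d` for Right changes nothing. -/
theorem firstWins_insert_of_lt {SL SR : Finset ℕ} (hSL : ∀ s ∈ SL, 0 < s)
    (hSR : ∀ s ∈ SR, 0 < s) {d : ℕ} (n : ℕ) (hn : n < d) :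
    (LeftFirstWins SL (insert d SR) n ↔ LeftFirstWins SL SR n) ∧
      (RightFirstWins SL (insert d SR) n ↔ RightFirstWins SL SR n) := by
  induction n using Nat.strong_induction_on with
  | _ n ih =>
    have hins : ∀ s ∈ insert d SR, 0 < s := by
      intro s hs
      rcases Finset.mem_insert.1 hs with rfl | hs
      · omega
      · exact hSR s hs
    rw [leftFirstWins_iff hSL, leftFirstWins_iff hSL, rightFirstWins_iff hins,
      rightFirstWins_iff hSR]
    constructor
    · refine exists_congr fun s => and_congr_right fun hs => and_congr_right fun hsn => ?_
      have := hSL s hs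
      rw [(ih (n - s) (by omega) (by omega)).2]
    · constructor
      · rintro ⟨s, hs, hsn, hw⟩
        rcases Finset.mem_insert.1 hs with rfl | hs
        · omega
        · have := hSR s hs
          exact ⟨s, hs, hsn, by rwa [← (ih (n - s) (by omega) (by omega)).1]⟩
      · rintro ⟨s, hs, hsn, hw⟩
        have := hSR s hs
        exact ⟨s, Finset.mem_insert_of_mem hs, hsn,
          by rwa [(ih (n - s) (by omega) (by omega)).1]⟩

/-- `U n` says that Left, moving first, loses on a heap of size `n`, and `V n` that Right, moving
first, wins, where Right may subtract `d` or an element of `SR`. Both fail for `p < n < d`. -/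
structure LosingPair (SL SR : Finset ℕ) (p x₁ x₂ d : ℕ) (U V : ℕ → Prop) : Prop where
  left_iff : ∀ n, U n ↔ ∀ x ∈ SL, x ≤ n → V (n - x)
  right_iff : ∀ n, V n ↔ (∃ s ∈ SR, s ≤ n ∧ U (n - s)) ∨ (d ≤ n ∧ U (n - d))
  mem_fst : x₁ ∈ SL
  mem_snd : x₂ ∈ SL
  fst_lt_snd : x₁ < x₂
  left_pos : ∀ x ∈ SL, 0 < x
  right_pos : ∀ s ∈ SR, 0 < s
  add_lt : ∀ s ∈ SR, p + s < d
  add_sub_lt : p + (x₂ - x₁) < d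
  not_left : ∀ n, p < n → n < d → ¬ U n
  not_right : ∀ n, p < n → n < d → ¬ V n

namespace LosingPair

variable {SL SR : Finset ℕ} {p x₁ x₂ d : ℕ} {U V : ℕ → Prop}

theorem not_left_of_lt (h : LosingPair SL SR p x₁ x₂ d U V) {m : ℕ} (hm : p + x₁ < m)
    (hm' : m < d + x₂) : ¬ U m := by
  intro hU
  have hx := h.fst_lt_snd
  have hd := h.add_sub_lt
  have hV₁ := (h.left_iff m).1 hU x₁ h.mem_fst (by omega)
  have h₁ : d ≤ m - x₁ := by
    by_contra hlt
    exact h.not_right _ (by omega) (by omega) hV₁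
  have hV₂ := (h.left_iff m).1 hU x₂ h.mem_snd (by omega)
  exact h.not_right _ (by omega) (by omega) hV₂

/-- On heaps of size at least `d` every win of Right is achieved by subtracting `d`. -/
theorem left_sub_of_right (h : LosingPair SL SR p x₁ x₂ d U V) (q : ℕ) (hq : d ≤ q)
    (hV : V q) : U (q - d) := by
  induction q using Nat.strong_induction_on with
  | _ q ih =>
    rcases (h.right_iff q).1 hV with ⟨s, hs, hsq, hU⟩ | ⟨-, hU⟩
    · have hsd := h.add_lt s hs
      have hs₀ := h.right_pos s hs
      refine (h.left_iff _).2 fun x hx hxq => ?_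
      have hx₀ := h.left_pos x hx
      have hV' := (h.left_iff _).1 hU x hx (by omega)
      have hge : d ≤ q - s - x := by
        by_contra hlt
        exact h.not_right _ (by omega) (by omega) hV'
      have hU' := ih (q - s - x) (by omega) hge hV'
      refine (h.right_iff _).2 (Or.inl ⟨s, hs, by omega, ?_⟩)
      rwa [show q - d - x - s = q - s - x - d by omega]
    · exact hU

theorem shift (h : LosingPair SL SR p x₁ x₂ d U V) (n : ℕ) :
    (U (n + (d + x₂)) → U n) ∧ (V (n + (d + x₂)) → V n) := by
  induction n using Nat.strong_induction_on with
  | _ n ih =>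
    have hx := h.fst_lt_snd
    have hd := h.add_sub_lt
    constructor
    · intro hU
      refine (h.left_iff _).2 fun x hx hxn => ?_
      have hx₀ := h.left_pos x hx
      refine (ih (n - x) (by omega)).2 ?_
      rw [show n - x + (d + x₂) = n + (d + x₂) - x by omega]
      exact (h.left_iff _).1 hU x hx (by omega)
    · intro hV
      rcases (h.right_iff _).1 hV with ⟨s, hs, -, hU⟩ | ⟨-, hU⟩
      · have hsd := h.add_lt s hs
        have hs₀ := h.right_pos s hs
        have hsn : s ≤ n := by
          by_contra hlt
          exact h.not_left_of_lt (by omega) (by omega) hU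
        refine (h.right_iff _).2 (Or.inl ⟨s, hs, hsn, (ih (n - s) (by omega)).1 ?_⟩)
        rwa [show n - s + (d + x₂) = n + (d + x₂) - s by omega]
      · by_cases hdn : d ≤ n
        · refine (h.right_iff _).2 (Or.inr ⟨hdn, (ih (n - d) (by omega)).1 ?_⟩)
          rwa [show n - d + (d + x₂) = n + (d + x₂) - d by omega]
        · have := (h.left_iff _).1 hU x₂ h.mem_snd (by omega)
          rwa [show n + (d + x₂) - d - x₂ = n by omega] at this

theorem shift_add_sub (h : LosingPair SL SR p x₁ x₂ d U V) (n : ℕ) :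
    (U (n + (d + x₂)) → U (n + (x₂ - x₁))) ∧ (V (n + (d + x₂)) → V (n + (x₂ - x₁))) := by
  induction n using Nat.strong_induction_on with
  | _ n ih =>
    have hx := h.fst_lt_snd
    have hd := h.add_sub_lt
    constructor
    · intro hU
      refine (h.left_iff _).2 fun x hx hxn => ?_
      have hx₀ := h.left_pos x hx
      have hV := (h.left_iff _).1 hU x hx (by omega)
      by_cases hxn' : x ≤ n
      · rw [show n + (x₂ - x₁) - x = n - x + (x₂ - x₁) by omega]
        refine (ih (n - x) (by omega)).2 ?_
        rwa [show n - x + (d + x₂) = n + (d + x₂) - x by omega]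
      · have hU' := h.left_sub_of_right _ (by omega) hV
        have hV' := (h.left_iff _).1 hU' x₁ h.mem_fst (by omega)
        rwa [show n + (d + x₂) - x - d - x₁ = n + (x₂ - x₁) - x by omega] at hV'
    · intro hV
      rcases (h.right_iff _).1 hV with ⟨s, hs, -, hU⟩ | ⟨-, hU⟩
      · have hsd := h.add_lt s hs
        have hs₀ := h.right_pos s hs
        have hsn : s ≤ n := by
          by_contra hlt
          exact h.not_left_of_lt (by omega) (by omega) hU
        refine (h.right_iff _).2 (Or.inl ⟨s, hs, by omega, ?_⟩)
        rw [show n + (x₂ - x₁) - s = n - s + (x₂ - x₁) by omega]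
        refine (ih (n - s) (by omega)).1 ?_
        rwa [show n - s + (d + x₂) = n + (d + x₂) - s by omega]
      · by_cases hdn : d ≤ n
        · refine (h.right_iff _).2 (Or.inr ⟨by omega, ?_⟩)
          rw [show n + (x₂ - x₁) - d = n - d + (x₂ - x₁) by omega]
          refine (ih (n - d) (by omega)).1 ?_
          rwa [show n - d + (d + x₂) = n + (d + x₂) - d by omega]
        · have := (h.left_iff _).1 hU x₁ h.mem_fst (by omega)
          rwa [show n + (d + x₂) - d - x₁ = n + (x₂ - x₁) by omega] at this

theorem not_left_block (h : LosingPair SL SR p x₁ x₂ d U V) (j r : ℕ) (hr : r < d + x₂)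
    (hj : d + x₂ ≤ r + (j + 1) * (x₂ - x₁)) : ¬ U (j * (d + x₂) + r) := by
  have hx := h.fst_lt_snd
  have hd := h.add_sub_lt
  induction j generalizing r with
  | zero =>
    rw [zero_mul, zero_add]
    exact h.not_left_of_lt (by omega) hr
  | succ j ih =>
    intro hU
    rw [show (j + 1) * (d + x₂) + r = j * (d + x₂) + r + (d + x₂) by ring] at hU
    by_cases hr' : d + x₂ ≤ r + (x₂ - x₁)
    · exact ih r hr (by nlinarith) ((h.shift _).1 hU)
    · have hU' := (h.shift_add_sub _).1 hU
      rw [add_assoc] at hU'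
      exact ih _ (by omega) (by linarith) hU'

theorem not_left_of_ge (h : LosingPair SL SR p x₁ x₂ d U V) {k n : ℕ}
    (hk : d + x₂ ≤ (k + 1) * (x₂ - x₁)) (hn : k * (d + x₂) ≤ n) : ¬ U n := by
  have hB : 0 < d + x₂ := by have := h.fst_lt_snd; omega
  have hkn : k ≤ n / (d + x₂) := (Nat.le_div_iff_mul_le hB).2 hn
  have hmul := Nat.mul_le_mul_right (x₂ - x₁) (Nat.add_le_add_right hkn 1)
  have := h.not_left_block (n / (d + x₂)) (n % (d + x₂)) (Nat.mod_lt _ hB) (by omega)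
  rwa [Nat.div_add_mod'] at this

theorem not_right_of_ge (h : LosingPair SL SR p x₁ x₂ d U V) {k n : ℕ}
    (hk : d + x₂ ≤ (k + 1) * (x₂ - x₁)) (hn : (k + 1) * (d + x₂) ≤ n) : ¬ V n := by
  rw [add_mul, one_mul] at hn
  intro hV
  rcases (h.right_iff _).1 hV with ⟨s, hs, -, hU⟩ | ⟨-, hU⟩
  · have := h.add_lt s hs
    exact h.not_left_of_ge hk (by omega) hU
  · exact h.not_left_of_ge hk (by omega) hU

end LosingPair

theorem stmt_18 (SL SR : Finset ℕ) (hSL : ∀ s ∈ SL, 0 < s) (hSR : ∀ s ∈ SR, 0 < s)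
    (hcard : 2 ≤ SL.card) (p : ℕ)
    (hL : ∀ n > p, outcome SL SR n = .L)
    (x₁ x₂ : ℕ) (hx₁ : x₁ ∈ SL) (hx₂ : x₂ ∈ SL) (hx : x₁ < x₂)
    (d : ℕ) (hd₁ : ∀ s ∈ SR, p + s < d) (hd₂ : p + (x₂ - x₁) < d) :
    ∀ n > (d + x₂) * ((d + x₂ + (x₂ - x₁) - 1) / (x₂ - x₁)),
      outcome SL (insert d SR) n = .L := by
  have hins : ∀ s ∈ insert d SR, 0 < s := by
    intro s hs
    rcases Finset.mem_insert.1 hs with rfl | hs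
    · omega
    · exact hSR s hs
  have h : LosingPair SL SR p x₁ x₂ d (fun n => ¬ LeftFirstWins SL (insert d SR) n)
      (RightFirstWins SL (insert d SR)) :=
    { left_iff := fun n => by
        rw [leftFirstWins_iff hSL]
        push Not
        rfl
      right_iff := fun n => by
        rw [rightFirstWins_iff hins]
        simp only [Finset.mem_insert, or_and_right, exists_or, exists_eq_left]
        exact or_comm
      mem_fst := hx₁
      mem_snd := hx₂
      fst_lt_snd := hx
      left_pos := hSL
      right_pos := hSR
      add_lt := hd₁
      add_sub_lt := hd₂
      not_left := fun n hp hd => by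
        rw [(firstWins_insert_of_lt hSL hSR n hd).1, not_not]
        exact ((outcome_eq_L_iff SL SR n).1 (hL n hp)).1
      not_right := fun n hp hd => by
        rw [(firstWins_insert_of_lt hSL hSR n hd).2]
        exact ((outcome_eq_L_iff SL SR n).1 (hL n hp)).2 }
  intro n hn
  set δ := x₂ - x₁ with hδ
  have hδ₀ : 0 < δ := by omega
  have hceil : d + x₂ ≤ (d + x₂ + δ - 1) / δ * δ := by
    have h₁ := Nat.div_add_mod' (d + x₂ + δ - 1) δ
    have h₂ := Nat.mod_lt (d + x₂ + δ - 1) hδ₀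
    omega
  obtain ⟨k, hk⟩ : ∃ k, (d + x₂ + δ - 1) / δ = k + 1 := by
    refine Nat.exists_eq_succ_of_ne_zero fun h₀ => ?_
    rw [h₀] at hceil
    omega
  rw [hk] at hn hceil
  rw [mul_comm] at hn
  refine (outcome_eq_L_iff _ _ _).2 ⟨?_, h.not_right_of_ge hceil hn.le⟩
  exact not_not.1 (h.not_left_of_ge hceil (by rw [add_mul] at hn; omega))
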